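/- Let R be a commutative domain with field of fractions Q, B an R-algebra, and M a right B-module. Then GKdim(M) = GKdim(Q ⊗_R M), where Q ⊗_R M is viewed as a right module over the Q-algebra Q ⊗_R B. -/

import Mathlib

open TensorProduct Filter
open scoped ENNReal

/-- The rank of an `R`-module `M` over a commutative domain `R`:
the dimension over the field of fractions `Q = Frac(R)` of `Q ⊗[R] M`
(as a natural number; all modules to which this is applied are finitely generated,
so their rank is finite). -/
noncomputable def modRank (R : Type*) [CommRing R] [IsDomain R]
    (M : Type*) [AddCommGroup M] [Module R M] : ℕ :=
  Module.finrank (FractionRing R) (FractionRing R ⊗[R] M)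

/-- A frame of an `R`-algebra `B` is a finitely generated `R`-submodule of `B`
containing `1`. -/
def IsFrame (R : Type*) [CommRing R] {B : Type*} [Ring B] [Algebra R B]
    (V : Submodule R B) : Prop :=
  V.FG ∧ (1 : B) ∈ V

/-- The Gelfand-Kirillov dimension of an `R`-algebra `B` over a commutative domain `R`:
`GKdim(B) = sup_V limsup_{n → ∞} log_n (rank V^n)`, where `V` ranges over all
frames of `B`. -/
noncomputable def GKdim (R : Type*) [CommRing R] [IsDomain R]
    (B : Type*) [Ring B] [Algebra R B] : ℝ≥0∞ :=
  ⨆ (V : Submodule R B) (_ : IsFrame R V),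
    Filter.limsup
      (fun n : ℕ => ENNReal.ofReal (Real.logb n (modRank R ↥(V ^ n)))) Filter.atTop

/-- For a right `B`-module `M` (a module over `Bᵐᵒᵖ`), and `R`-submodules `F ⊆ M`,
`W ⊆ B`, this is the `R`-submodule `F·W` of `M` generated by the products `m · z`
with `m ∈ F` and `z ∈ W`. -/
def rightSMulSpan (R : Type*) [CommRing R] {B : Type*} [Ring B] [Algebra R B]
    {M : Type*} [AddCommGroup M] [Module R M] [Module Bᵐᵒᵖ M]
    (F : Submodule R M) (W : Submodule R B) : Submodule R M :=
  Submodule.span R {y : M | ∃ m ∈ F, ∃ z ∈ W, y = MulOpposite.op z • m}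

/-- The Gelfand-Kirillov dimension of a right `B`-module `M` over a commutative domain
`R`: `GKdim(M) = sup_{V, F} limsup_{n → ∞} log_n (rank F·Vⁿ)`, where `V` ranges over
all frames of `B` and `F` over all finitely generated `R`-submodules of `M`. -/
noncomputable def GKdimMod (R : Type*) [CommRing R] [IsDomain R]
    (B : Type*) [Ring B] [Algebra R B]
    (M : Type*) [AddCommGroup M] [Module R M] [Module Bᵐᵒᵖ M] : ℝ≥0∞ :=
  ⨆ (V : Submodule R B) (_ : IsFrame R V) (F : Submodule R M) (_ : F.FG),
    Filter.limsup
      (fun n : ℕ =>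
        ENNReal.ofReal (Real.logb n (modRank R ↥(rightSMulSpan R F (V ^ n))))) Filter.atTop

namespace Submodule

open scoped Pointwise in
theorem baseChange_pow {R : Type*} [CommRing R] (A : Type*) [CommRing A] [Algebra R A]
    {B : Type*} [Ring B] [Algebra R B] (V : Submodule R B) (n : ℕ) :
    (V ^ n).baseChange A = V.baseChange A ^ n := by
  have key (s : Set B) : TensorProduct.mk R A B 1 '' (s ^ n) = (TensorProduct.mk R A B 1 '' s) ^ n :=
    Set.image_pow (Algebra.TensorProduct.includeRight : B →ₐ[R] A ⊗[R] B) s n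
  rw [← span_eq V, span_pow, baseChange_span, baseChange_span, span_pow, key]

variable {R : Type*} [CommRing R] (A : Type*) [CommRing A] [Algebra R A]
  {M : Type*} [AddCommGroup M] [Module R M]

theorem FG.baseChange {N : Submodule R M} (hN : N.FG) : (N.baseChange A).FG := by
  obtain ⟨s, hs, rfl⟩ := fg_def.mp hN
  rw [baseChange_span]
  exact fg_span (hs.image _)

variable {A}

theorem exists_fg_mem_baseChange (x : A ⊗[R] M) :
    ∃ N : Submodule R M, N.FG ∧ x ∈ N.baseChange A := by
  induction x with
  | zero => exact ⟨⊥, fg_bot, zero_mem _⟩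
  | tmul a m =>
    exact ⟨span R {m}, fg_span_singleton m, tmul_mem_baseChange_of_mem a (mem_span_singleton_self m)⟩
  | add x y hx hy =>
    obtain ⟨N, hN, hxN⟩ := hx
    obtain ⟨P, hP, hyP⟩ := hy
    exact ⟨N ⊔ P, hN.sup hP, add_mem (baseChange_mono _ le_sup_left hxN)
      (baseChange_mono _ le_sup_right hyP)⟩

theorem FG.exists_le_baseChange {N' : Submodule A (A ⊗[R] M)} (hN' : N'.FG) :
    ∃ N : Submodule R M, N.FG ∧ N' ≤ N.baseChange A := by
  induction N', hN' using fg_induction with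
  | singleton x =>
    obtain ⟨N, hN, hx⟩ := exists_fg_mem_baseChange x
    exact ⟨N, hN, (span_singleton_le_iff_mem _ _).mpr hx⟩
  | sup N₁ N₂ _ _ h₁ h₂ =>
    obtain ⟨P₁, hP₁, hN₁⟩ := h₁
    obtain ⟨P₂, hP₂, hN₂⟩ := h₂
    exact ⟨P₁ ⊔ P₂, hP₁.sup hP₂, sup_le (hN₁.trans (baseChange_mono _ le_sup_left))
      (hN₂.trans (baseChange_mono _ le_sup_right))⟩

end Submodule

section RightSMulSpan

variable {R : Type*} [CommRing R] {B : Type*} [Ring B] [Algebra R B]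
  {M : Type*} [AddCommGroup M] [Module R M] [Module Bᵐᵒᵖ M]

/-- The right action of `B` on a right `B`-module `M`, as an `R`-bilinear map. -/
def rightSMulBilin (hbimod : ∀ (r : R) (m : M), r • m = MulOpposite.op (algebraMap R B r) • m) :
    M →ₗ[R] B →ₗ[R] M :=
  LinearMap.mk₂ R (fun m b => MulOpposite.op b • m)
    (fun m m' b => smul_add _ m m')
    (fun r m b => by
      simp only [hbimod, smul_smul, ← MulOpposite.op_mul, Algebra.commutes])
    (fun m b b' => by rw [MulOpposite.op_add, add_smul])
    (fun r m b => by
      simp only [hbimod, smul_smul, ← MulOpposite.op_mul, Algebra.smul_def, Algebra.commutes])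

theorem rightSMulSpan_eq_map₂
    (hbimod : ∀ (r : R) (m : M), r • m = MulOpposite.op (algebraMap R B r) • m)
    (F : Submodule R M) (W : Submodule R B) :
    rightSMulSpan R F W = Submodule.map₂ (rightSMulBilin hbimod) F W := by
  rw [Submodule.map₂_eq_span_image2, rightSMulSpan]
  congr 1
  ext y
  simp [Set.mem_image2, rightSMulBilin, eq_comm]

theorem rightSMulSpan_mono {F F' : Submodule R M} {W W' : Submodule R B}
    (hF : F ≤ F') (hW : W ≤ W') : rightSMulSpan R F W ≤ rightSMulSpan R F' W' :=
  Submodule.span_mono fun _ ⟨m, hm, z, hz, h⟩ => ⟨m, hF hm, z, hW hz, h⟩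

theorem rightSMulSpan_fg
    (hbimod : ∀ (r : R) (m : M), r • m = MulOpposite.op (algebraMap R B r) • m)
    {F : Submodule R M} {W : Submodule R B} (hF : F.FG) (hW : W.FG) :
    (rightSMulSpan R F W).FG := by
  rw [rightSMulSpan_eq_map₂ hbimod]
  exact hF.map₂ _ hW

variable {A : Type*} [CommRing A] [Algebra R A] [Module (A ⊗[R] B)ᵐᵒᵖ (A ⊗[R] M)]

theorem smul_eq_op_algebraMap_smul_tensor
    (hact : ∀ (q q' : A) (b : B) (m : M),
      MulOpposite.op (q ⊗ₜ[R] b) • (q' ⊗ₜ[R] m) = (q * q') ⊗ₜ[R] (MulOpposite.op b • m))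
    (q : A) (x : A ⊗[R] M) :
    q • x = MulOpposite.op (algebraMap A (A ⊗[R] B) q) • x := by
  induction x with
  | zero => simp
  | add x y hx hy => rw [smul_add, smul_add, hx, hy]
  | tmul q' m =>
    rw [Algebra.TensorProduct.algebraMap_apply, hact, MulOpposite.op_one, one_smul,
      Algebra.algebraMap_self_apply, TensorProduct.smul_tmul', smul_eq_mul]

theorem rightSMulSpan_baseChange
    (hbimod : ∀ (r : R) (m : M), r • m = MulOpposite.op (algebraMap R B r) • m)
    (hact : ∀ (q q' : A) (b : B) (m : M),
      MulOpposite.op (q ⊗ₜ[R] b) • (q' ⊗ₜ[R] m) = (q * q') ⊗ₜ[R] (MulOpposite.op b • m))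
    (F : Submodule R M) (W : Submodule R B) :
    rightSMulSpan A (F.baseChange A) (W.baseChange A) = (rightSMulSpan R F W).baseChange A := by
  rw [rightSMulSpan_eq_map₂ (smul_eq_op_algebraMap_smul_tensor hact),
    rightSMulSpan_eq_map₂ hbimod, Submodule.map₂_eq_span_image2 _ F W,
    Submodule.baseChange_span, Submodule.baseChange_eq_span A F, Submodule.baseChange_eq_span A W,
    Submodule.map₂_span_span, Submodule.map_coe, Submodule.map_coe,
    Set.image2_image_left, Set.image2_image_right, Set.image_image2]
  simp [rightSMulBilin, hact]

end RightSMulSpan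

section ModRank

theorem modRank_eq_finrank (K : Type*) [Field K] (N : Type*) [AddCommGroup N] [Module K N] :
    modRank K N = Module.finrank K N :=
  Module.finrank_baseChange

variable {R : Type*} [CommRing R] [IsDomain R] {M : Type*} [AddCommGroup M] [Module R M]

theorem modRank_baseChange (N : Submodule R M) :
    modRank (FractionRing R) (N.baseChange (FractionRing R)) = modRank R N := by
  rw [modRank_eq_finrank, modRank]
  exact (Submodule.toBaseChange.toLinearEquiv (FractionRing R) N).finrank_eq.symm

theorem modRank_mono {K : Type*} [Field K] {E : Type*} [AddCommGroup E] [Module K E]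
    {N P : Submodule K E} (h : N ≤ P) (hP : P.FG) : modRank K N ≤ modRank K P := by
  rw [modRank_eq_finrank, modRank_eq_finrank]
  have : Module.Finite K P := Module.Finite.iff_fg.mpr hP
  exact Submodule.finrank_mono h

end ModRank

theorem ofReal_logb_natCast_mono (n : ℕ) {a b : ℕ} (h : a ≤ b) :
    ENNReal.ofReal (Real.logb n a) ≤ ENNReal.ofReal (Real.logb n b) := by
  refine ENNReal.ofReal_le_ofReal ?_
  rcases Nat.eq_zero_or_pos a with rfl | ha
  · rw [Nat.cast_zero, Real.logb_zero]
    exact div_nonneg (Real.log_natCast_nonneg b) (Real.log_natCast_nonneg n)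
  · exact div_le_div_of_nonneg_right
      (Real.log_le_log (by exact_mod_cast ha) (by exact_mod_cast h)) (Real.log_natCast_nonneg n)

/-- Let `R` be a commutative domain with field of fractions `Q`, `B`
an `R`-algebra and `M` a right `B`-module (so an `R`-`B`-bimodule via
`r • m = m · (r·1)`).  Viewing `Q ⊗[R] M` as a right module over the `Q`-algebra
`Q ⊗[R] B` via `(q' ⊗ m) · (q ⊗ b) = (q'q) ⊗ (m·b)`, we have
`GKdim(M) = GKdim(Q ⊗[R] M)`. -/
theorem GKdimMod_eq_GKdimMod_fractionRing_tensor (R : Type*) [CommRing R] [IsDomain R]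
    (B : Type*) [Ring B] [Algebra R B]
    (M : Type*) [AddCommGroup M] [Module R M] [Module Bᵐᵒᵖ M]
    (hbimod : ∀ (r : R) (m : M), r • m = MulOpposite.op (algebraMap R B r) • m)
    [Module (FractionRing R ⊗[R] B)ᵐᵒᵖ (FractionRing R ⊗[R] M)]
    (hact : ∀ (q q' : FractionRing R) (b : B) (m : M),
      MulOpposite.op (q ⊗ₜ[R] b) • (q' ⊗ₜ[R] m) = (q * q') ⊗ₜ[R] (MulOpposite.op b • m)) :
    GKdimMod R B M =
      GKdimMod (FractionRing R) (FractionRing R ⊗[R] B) (FractionRing R ⊗[R] M) := by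
  have hbimod' := smul_eq_op_algebraMap_smul_tensor hact
  have hrank (V : Submodule R B) (F : Submodule R M) (n : ℕ) :
      modRank (FractionRing R) (rightSMulSpan (FractionRing R) (F.baseChange (FractionRing R))
        (V.baseChange (FractionRing R) ^ n)) = modRank R (rightSMulSpan R F (V ^ n)) := by
    rw [← Submodule.baseChange_pow, rightSMulSpan_baseChange hbimod hact, modRank_baseChange]
  apply le_antisymm
  · refine iSup₂_le fun V hV => iSup₂_le fun F hF => ?_
    simp_rw [← hrank V F]
    exact le_iSup₂_of_le (V.baseChange (FractionRing R))
      ⟨hV.1.baseChange _, Submodule.tmul_mem_baseChange_of_mem 1 hV.2⟩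
      (le_iSup₂_of_le (F.baseChange (FractionRing R)) (hF.baseChange _) le_rfl)
  · refine iSup₂_le fun V' hV' => iSup₂_le fun F' hF' => ?_
    obtain ⟨V, hV, hVV'⟩ := hV'.1.exists_le_baseChange
    obtain ⟨F, hF, hFF'⟩ := hF'.exists_le_baseChange
    have hV₁ : (V ⊔ Submodule.span R {1}).FG := hV.sup (Submodule.fg_span_singleton 1)
    refine le_iSup₂_of_le (V ⊔ Submodule.span R {1})
      ⟨hV₁, Submodule.mem_sup_right (Submodule.mem_span_singleton_self 1)⟩
      (le_iSup₂_of_le F hF ?_)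
    refine limsup_le_limsup (Eventually.of_forall fun n => ofReal_logb_natCast_mono n ?_)
    rw [← hrank]
    refine modRank_mono (rightSMulSpan_mono hFF' ?_)
      (rightSMulSpan_fg hbimod' (hF.baseChange _) ((hV₁.baseChange _).pow n))
    exact pow_le_pow_left' (hVV'.trans (Submodule.baseChange_mono _ le_sup_left)) n
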